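/- arXiv:1105.4207 — 4 statements merged into one kernel-verified Lean document; each statement's English description precedes it below -/
import Mathlib

section
/- In the affine braid group B_k, define X^{ε_i} = T_{i−1}T_{i−2}⋯T_2T_1 X^{ε_1} T_1T_2⋯T_{i−2}T_{i−1} for i = 1,…,k. Then the elements X^{ε_1},…,X^{ε_k} pairwise commute: X^{ε_i}X^{ε_j} = X^{ε_j}X^{ε_i} for all 1 ≤ i, j ≤ k. -/
/-- Data of a group `G` together with elements satisfying the defining relations of the
affine braid group `B_k`.  Indexing is 0-based: the paper's `T_i` (for `1 ≤ i ≤ k-1`) is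
`T (i-1) _` here, and `X` is `X^{ε₁}`. -/
structure AffineBraidRep (k : ℕ) (G : Type*) [Group G] where
  T : ∀ i : ℕ, i + 1 < k → G
  X : G
  braid_far : ∀ i j (hi : i + 1 < k) (hj : j + 1 < k), i + 2 ≤ j →
      T i hi * T j hj = T j hj * T i hi
  braid : ∀ i (h : i + 2 < k),
      T i (by omega) * T (i + 1) h * T i (by omega) =
        T (i + 1) h * T i (by omega) * T (i + 1) h
  XTXT : ∀ h : 1 < k, X * T 0 h * X * T 0 h = T 0 h * X * T 0 h * X
  X_T : ∀ i (h : i + 1 < k), 1 ≤ i → X * T i h = T i h * X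

/-- The element `X^{ε_i}` of the affine braid group (0-indexed: `Xe B i` is the paper's
`X^{ε_{i+1}} = T_i ⋯ T_1 X^{ε_1} T_1 ⋯ T_i`); the value for out-of-range indices is junk. -/
def AffineBraidRep.Xe {k : ℕ} {G : Type*} [Group G] (B : AffineBraidRep k G) : ℕ → G
  | 0 => B.X
  | i + 1 => if h : i + 1 < k then B.T i h * B.Xe i * B.T i h else 1

namespace AffineBraidRep

variable {k : ℕ} {G : Type*} [Group G] (B : AffineBraidRep k G)

theorem Xe_succ {i : ℕ} (h : i + 1 < k) : B.Xe (i + 1) = B.T i h * B.Xe i * B.T i h := by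
  simp [Xe, h]

theorem commute_Xe_T {i j : ℕ} (hj : j + 1 < k) (hij : i < j) : Commute (B.Xe i) (B.T j hj) := by
  induction i with
  | zero => exact B.X_T j hj hij
  | succ i ih =>
    have hT : Commute (B.T i (by omega)) (B.T j hj) := B.braid_far i j (by omega) hj hij
    rw [B.Xe_succ (by omega)]
    exact (hT.mul_left (ih (by omega))).mul_left hT

/-- If `a`, `b` satisfy the braid relation, `y` commutes with `b`, and `y`, `a` satisfy the
type `B` braid relation, then `a * y * a` and `b` satisfy the type `B` braid relation. -/
theorem commute_conj_of_braid {M : Type*} [Monoid M] {a b y : M} (hab : a * b * a = b * a * b)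
    (hyb : Commute y b) (hya : Commute y (a * y * a)) :
    Commute (a * y * a) (b * (a * y * a) * b) := by
  have hya' : y * a * y * a = a * y * a * y := by
    simpa only [mul_assoc] using hya.eq
  have hyb' : y * b = b * y := hyb
  calc a * y * a * (b * (a * y * a) * b)
      = a * y * (a * b * a) * y * a * b := by simp only [mul_assoc]
    _ = a * (y * b) * a * (b * y) * a * b := by rw [hab]; simp only [mul_assoc]
    _ = a * (b * y) * a * (y * b) * a * b := by rw [hyb']
    _ = a * b * y * a * y * (b * a * b) := by simp only [mul_assoc]
    _ = a * b * (y * a * y * a) * b * a := by rw [← hab]; simp only [mul_assoc]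
    _ = (a * b * a) * y * a * (y * b) * a := by rw [hya']; simp only [mul_assoc]
    _ = b * a * (b * y) * a * (y * b) * a := by rw [hab]; simp only [mul_assoc]
    _ = b * a * (y * b) * a * (b * y) * a := by rw [hyb']
    _ = b * a * y * (b * a * b) * y * a := by simp only [mul_assoc]
    _ = b * (a * y * a) * b * (a * y * a) := by rw [← hab]; simp only [mul_assoc]

theorem commute_Xe_succ {i : ℕ} (h : i + 1 < k) : Commute (B.Xe i) (B.Xe (i + 1)) := by
  induction i with
  | zero =>
    rw [B.Xe_succ h]
    simpa only [Commute, SemiconjBy, Xe, mul_assoc] using B.XTXT h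
  | succ i ih =>
    have hi : i + 1 < k := by omega
    have hcomm := ih hi
    rw [B.Xe_succ hi] at hcomm
    rw [B.Xe_succ h, B.Xe_succ hi]
    exact commute_conj_of_braid (B.braid i h) (B.commute_Xe_T h (Nat.lt_succ_self i)) hcomm

theorem commute_Xe_of_lt {i j : ℕ} (hij : i < j) (hj : j < k) :
    Commute (B.Xe i) (B.Xe j) := by
  induction j, hij using Nat.le_induction with
  | base => exact B.commute_Xe_succ hj
  | succ j hij ih =>
    have hT := B.commute_Xe_T hj hij
    rw [B.Xe_succ hj]
    exact (hT.mul_right (ih (by omega))).mul_right hT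

end AffineBraidRep

/-- in the affine braid group `B_k`, the elements
`X^{ε_i} = T_{i-1} ⋯ T_1 X^{ε_1} T_1 ⋯ T_{i-1}`, `1 ≤ i ≤ k`, pairwise commute. -/
theorem affine_braid_Xe_commute (k : ℕ) (G : Type*) [Group G]
    (B : AffineBraidRep k G) :
    ∀ i j, i < k → j < k → B.Xe i * B.Xe j = B.Xe j * B.Xe i := by
  intro i j hi hj
  rcases lt_trichotomy i j with h | rfl | h
  · exact B.commute_Xe_of_lt h hj
  · rfl
  · exact (B.commute_Xe_of_lt h hi).symm
end

section
/- In the degenerate affine BMW algebra 𝓦_k the following identities hold (whenever all indices involved lie in the allowed ranges 1 ≤ i ≤ k−1, respectively 1 ≤ i ≤ k−2): (i) y_i t_{s_i} = t_{s_i} y_{i+1} − (1 − e_i); (ii) γ_{i,i+1} = t_{s_i} − ε e_i, where γ_{i,i+1} = y_{i+1} − t_{s_i} y_i t_{s_i}; (iii) e_{i+1} = t_{s_i} t_{s_{i+1}} e_i t_{s_{i+1}} t_{s_i}; (iv) e_i e_{i+1} e_i = e_i and e_{i+1} e_i e_{i+1} = e_{i+1}; (v) e_i² = z_0^{(0)}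 e_i. -/
/-- The simple transposition `sᵢ = (i, i+1)` (0-indexed) in the symmetric group on `Fin k`.
In the paper's 1-indexed notation, `sw k (i-1) _` is `s_i`. -/
def sw (k i : ℕ) (h : i + 1 < k) : Equiv.Perm (Fin k) :=
  Equiv.swap ⟨i, Nat.lt_of_succ_lt h⟩ ⟨i + 1, h⟩

/-- A `C`-algebra `A` together with elements satisfying the defining relations of the
degenerate affine BMW algebra `𝓦ₖ` with parameters `ε` and `z₀⁽ℓ⁾`.  Everything is
0-indexed: the paper's `s_i`, `y_i`, `e_i` (for `1 ≤ i`) are `sw k (i-1) _`, `y (i-1)`,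
`e (i-1) _` here.  The field `e_def` is the equation `t_{s_i} y_i = y_{i+1} t_{s_i} - (1 - e_i)`
defining `e_i`. -/
structure DegAffBMW (C : Type*) [CommRing C] (k : ℕ) (ε : C) (z₀ : ℕ → C)
    (A : Type*) [Ring A] [Algebra C A] where
  t : Equiv.Perm (Fin k) → A
  κ₀ : A
  κ₁ : A
  y : ℕ → A
  e : ∀ i : ℕ, i + 1 < k → A
  t_one : t 1 = 1
  t_mul : ∀ u v, t u * t v = t (u * v)
  y_comm : ∀ i j, i < k → j < k → y i * y j = y j * y i
  κ_comm : κ₀ * κ₁ = κ₁ * κ₀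
  κ₀_y : ∀ i, i < k → κ₀ * y i = y i * κ₀
  κ₁_y : ∀ i, i < k → κ₁ * y i = y i * κ₁
  κ₀_t : ∀ i (h : i + 1 < k), κ₀ * t (sw k i h) = t (sw k i h) * κ₀
  κ₁_braid : ∀ h : 1 < k,
      κ₁ * t (sw k 0 h) * κ₁ * t (sw k 0 h) = t (sw k 0 h) * κ₁ * t (sw k 0 h) * κ₁
  κ₁_t : ∀ j (h : j + 1 < k), j ≠ 0 → κ₁ * t (sw k j h) = t (sw k j h) * κ₁
  t_yy : ∀ i (h : i + 1 < k),
      t (sw k i h) * (y i + y (i + 1)) = (y i + y (i + 1)) * t (sw k i h)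
  y_t : ∀ i j (h : i + 1 < k), j < k → j ≠ i → j ≠ i + 1 →
      y j * t (sw k i h) = t (sw k i h) * y j
  γ_rel : ∀ i (h : i + 2 < k),
      t (sw k i (by omega)) * t (sw k (i + 1) h) *
          (y (i + 1) - t (sw k i (by omega)) * y i * t (sw k i (by omega))) *
          t (sw k (i + 1) h) * t (sw k i (by omega)) =
        y (i + 2) - t (sw k (i + 1) h) * y (i + 1) * t (sw k (i + 1) h)
  e_def : ∀ i (h : i + 1 < k),
      t (sw k i h) * y i = y (i + 1) * t (sw k i h) - (1 - e i h)
  e_t : ∀ i (h : i + 1 < k), e i h * t (sw k i h) = ε • e i h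
  t_e : ∀ i (h : i + 1 < k), t (sw k i h) * e i h = ε • e i h
  ete_up : ∀ i (h : i + 1 < k) (h' : i + 2 < k),
      e i h * t (sw k (i + 1) h') * e i h = ε • e i h
  ete_down : ∀ i (h : i + 1 < k) (h' : i - 1 + 1 < k), 1 ≤ i →
      e i h * t (sw k (i - 1) h') * e i h = ε • e i h
  eye : ∀ (h : 1 < k) (ℓ : ℕ), e 0 h * y 0 ^ ℓ * e 0 h = z₀ ℓ • e 0 h
  e_yy : ∀ i (h : i + 1 < k), e i h * (y i + y (i + 1)) = 0
  yy_e : ∀ i (h : i + 1 < k), (y i + y (i + 1)) * e i h = 0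

theorem sw_mul_self (k i : ℕ) (h : i + 1 < k) : sw k i h * sw k i h = 1 :=
  Equiv.swap_mul_self _ _

theorem sw_braid (k i : ℕ) (h : i + 2 < k) (h' : i + 1 < k) :
    sw k i h' * sw k (i + 1) h * sw k i h' = sw k (i + 1) h * sw k i h' * sw k (i + 1) h := by
  have h₁ : (⟨i, by omega⟩ : Fin k) ≠ ⟨i + 1, h'⟩ := by simp
  have h₂ : (⟨i, by omega⟩ : Fin k) ≠ ⟨i + 2, h⟩ := by simp
  have h₃ : (⟨i + 1, h'⟩ : Fin k) ≠ ⟨i + 2, h⟩ := by simp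
  unfold sw
  rw [Equiv.swap_mul_swap_mul_swap h₁ h₂, Equiv.swap_comm (⟨i, _⟩ : Fin k),
    Equiv.swap_comm _ (⟨i + 1 + 1, h⟩ : Fin k),
    Equiv.swap_mul_swap_mul_swap h₃.symm h₂.symm, Equiv.swap_comm]

namespace DegAffBMW

variable {C : Type*} [CommRing C] {k : ℕ} {ε : C} {z₀ : ℕ → C}
  {A : Type*} [Ring A] [Algebra C A] (B : DegAffBMW C k ε z₀ A)

theorem t_mul_self (i : ℕ) (h : i + 1 < k) : B.t (sw k i h) * B.t (sw k i h) = 1 := by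
  rw [B.t_mul, sw_mul_self, B.t_one]

theorem t_mul_self_assoc (i : ℕ) (h : i + 1 < k) (x : A) :
    B.t (sw k i h) * (B.t (sw k i h) * x) = x := by
  rw [← mul_assoc, B.t_mul_self, one_mul]

theorem t_braid (i : ℕ) (h : i + 2 < k) (h' : i + 1 < k) :
    B.t (sw k i h') * B.t (sw k (i + 1) h) * B.t (sw k i h') =
      B.t (sw k (i + 1) h) * B.t (sw k i h') * B.t (sw k (i + 1) h) := by
  simp only [B.t_mul, sw_braid k i h h']

theorem y_mul_t (i : ℕ) (h : i + 1 < k) :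
    B.y i * B.t (sw k i h) = B.t (sw k i h) * B.y (i + 1) - (1 - B.e i h) := by
  have h₁ := B.t_yy i h
  rw [mul_add, add_mul, B.e_def i h] at h₁
  rw [← sub_eq_zero] at h₁ ⊢
  rw [← neg_eq_zero, ← h₁]
  abel

theorem gamma_eq (i : ℕ) (h : i + 1 < k) :
    B.y (i + 1) - B.t (sw k i h) * B.y i * B.t (sw k i h) = B.t (sw k i h) - ε • B.e i h := by
  rw [B.e_def i h, sub_mul, sub_mul, mul_assoc, B.t_mul_self, B.e_t]
  noncomm_ring

theorem e_succ (hε : ε * ε = 1) (i : ℕ) (h : i + 2 < k) (h' : i + 1 < k) :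
    B.e (i + 1) h =
      B.t (sw k i h') * B.t (sw k (i + 1) h) * B.e i h' *
        B.t (sw k (i + 1) h) * B.t (sw k i h') := by
  have hγ := B.γ_rel i h
  have hb : B.t (sw k i h') * B.t (sw k (i + 1) h) * B.t (sw k i h') *
      B.t (sw k (i + 1) h) * B.t (sw k i h') = B.t (sw k (i + 1) h) := by
    rw [B.t_braid i h h']
    simp only [mul_assoc, B.t_mul_self, mul_one]
  rw [B.gamma_eq i h', B.gamma_eq (i + 1) h] at hγ
  simp only [mul_sub, sub_mul, mul_smul_comm, smul_mul_assoc] at hγ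
  rw [hb, sub_right_inj] at hγ
  simpa only [smul_smul, hε, one_smul] using (congrArg (ε • ·) hγ).symm

theorem e_eq_conj_succ (hε : ε * ε = 1) (i : ℕ) (h : i + 2 < k) (h' : i + 1 < k) :
    B.e i h' =
      B.t (sw k (i + 1) h) * B.t (sw k i h') * B.e (i + 1) h *
        B.t (sw k i h') * B.t (sw k (i + 1) h) := by
  rw [B.e_succ hε i h h']
  simp only [mul_assoc, B.t_mul_self_assoc, B.t_mul_self, mul_one]

theorem e_mul_e_succ_mul_e (hε : ε * ε = 1) (i : ℕ) (h : i + 2 < k) (h' : i + 1 < k) :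
    B.e i h' * B.e (i + 1) h * B.e i h' = B.e i h' := by
  calc
    _ = (B.e i h' * B.t (sw k i h')) * B.t (sw k (i + 1) h) * B.e i h' *
          B.t (sw k (i + 1) h) * (B.t (sw k i h') * B.e i h') := by
      rw [B.e_succ hε i h h']
      simp only [mul_assoc]
    _ = (ε * ε) • (B.e i h' * B.t (sw k (i + 1) h) * B.e i h' *
          B.t (sw k (i + 1) h) * B.e i h') := by
      rw [B.e_t, B.t_e]
      simp only [mul_smul_comm, smul_mul_assoc, smul_smul]
    _ = B.e i h' := by
      simp only [B.ete_up i h' h, smul_mul_assoc, smul_smul, hε, one_smul]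

theorem e_succ_mul_e_mul_e_succ (hε : ε * ε = 1) (i : ℕ) (h : i + 2 < k) (h' : i + 1 < k) :
    B.e (i + 1) h * B.e i h' * B.e (i + 1) h = B.e (i + 1) h := by
  have hete : B.e (i + 1) h * B.t (sw k i h') * B.e (i + 1) h = ε • B.e (i + 1) h :=
    B.ete_down (i + 1) h h' (Nat.le_add_left 1 i)
  calc
    _ = (B.e (i + 1) h * B.t (sw k (i + 1) h)) * B.t (sw k i h') * B.e (i + 1) h *
          B.t (sw k i h') * (B.t (sw k (i + 1) h) * B.e (i + 1) h) := by
      rw [B.e_eq_conj_succ hε i h h']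
      simp only [mul_assoc]
    _ = (ε * ε) • (B.e (i + 1) h * B.t (sw k i h') * B.e (i + 1) h *
          B.t (sw k i h') * B.e (i + 1) h) := by
      rw [B.e_t, B.t_e]
      simp only [mul_smul_comm, smul_mul_assoc, smul_smul]
    _ = B.e (i + 1) h := by
      simp only [hete, smul_mul_assoc, smul_smul, hε, one_smul]

theorem e_mul_self (hε : ε * ε = 1) (i : ℕ) (h : i + 1 < k) :
    B.e i h * B.e i h = z₀ 0 • B.e i h := by
  induction i with
  | zero => simpa using B.eye h 0
  | succ i ih =>
    have h' : i + 1 < k := Nat.lt_of_succ_lt h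
    calc
      _ = B.t (sw k i h') * B.t (sw k (i + 1) h) * (B.e i h' * B.e i h') *
            B.t (sw k (i + 1) h) * B.t (sw k i h') := by
        rw [B.e_succ hε i h h']
        simp only [mul_assoc, B.t_mul_self_assoc]
      _ = z₀ 0 • B.e (i + 1) h := by
        rw [ih h', B.e_succ hε i h h']
        simp only [mul_smul_comm, smul_mul_assoc]

end DegAffBMW

/-- identities (2.24)–(2.27) of the paper in the degenerate affine BMW
algebra `𝓦ₖ` (0-indexed): (i) `yᵢ t_{sᵢ} = t_{sᵢ} y_{i+1} - (1 - eᵢ)`;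
(ii) `γ_{i,i+1} = t_{sᵢ} - ε eᵢ`; (iii) `e_{i+1} = t_{sᵢ} t_{s_{i+1}} eᵢ t_{s_{i+1}} t_{sᵢ}`;
(iv) `eᵢ e_{i±1} eᵢ = eᵢ`; (v) `eᵢ² = z₀⁽⁰⁾ eᵢ`. -/
theorem degenerate_affine_BMW_identities
    (C : Type*) [CommRing C] (k : ℕ) (ε : C) (z₀ : ℕ → C)
    (A : Type*) [Ring A] [Algebra C A]
    (hk : 3 ≤ k) (hε : ε = 1 ∨ ε = -1)
    (B : DegAffBMW C k ε z₀ A) :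
    (∀ i (h : i + 1 < k),
        B.y i * B.t (sw k i h) = B.t (sw k i h) * B.y (i + 1) - (1 - B.e i h)) ∧
    (∀ i (h : i + 1 < k),
        B.y (i + 1) - B.t (sw k i h) * B.y i * B.t (sw k i h) =
          B.t (sw k i h) - ε • B.e i h) ∧
    (∀ i (h : i + 2 < k),
        B.e (i + 1) h =
          B.t (sw k i (by omega)) * B.t (sw k (i + 1) h) * B.e i (by omega) *
            B.t (sw k (i + 1) h) * B.t (sw k i (by omega))) ∧
    (∀ i (h : i + 2 < k),
        B.e i (by omega) * B.e (i + 1) h * B.e i (by omega) = B.e i (by omega) ∧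
        B.e (i + 1) h * B.e i (by omega) * B.e (i + 1) h = B.e (i + 1) h) ∧
    (∀ i (h : i + 1 < k), B.e i h * B.e i h = z₀ 0 • B.e i h) := by
  have hεε : ε * ε = 1 := by rcases hε with rfl | rfl <;> simp
  exact ⟨B.y_mul_t, B.gamma_eq, fun i h => B.e_succ hεε i h _,
    fun i h => ⟨B.e_mul_e_succ_mul_e hεε i h _, B.e_succ_mul_e_mul_e_succ hεε i h _⟩,
    B.e_mul_self hεε⟩
end

section
/- In the affine BMW algebra W_k the following identities hold (for all indices in the allowed ranges 1 ≤ i ≤ k−1, respectively 1 ≤ i ≤ k−2): (i) Y_i T_i = T_i Y_{i+1} − (q − q⁻¹)(1 − E_i)Y_{i+1}; (ii) E_i = 1 − (T_i − T_i⁻¹)/(q − q⁻¹); (iii) E_{i+1} = T_i T_{i+1} E_i T_{i+1}⁻¹ T_i⁻¹; (iv) E_i E_{i+1} E_i = E_i and E_{i+1} E_i E_{i+1} = E_{i+1}; (v) E_i² = (1 + (z − z⁻¹)/(q − q⁻¹)) E_i; (vi) (T_i − z⁻¹)(T_i + q⁻¹)(T_i − q) = 0. -/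
/-- A `C`-algebra `A` together with elements satisfying the defining relations of the
affine BMW algebra `W_k` with parameters `q, z ∈ Cˣ` and `Z₀⁽ℓ⁾ ∈ C` (`ℓ ∈ ℤ`).
Indexing is 0-based: the paper's `T_i, E_i` (for `1 ≤ i ≤ k-1`) are `T (i-1) _, E (i-1) _`
here, and the paper's `Y_i` (for `1 ≤ i ≤ k`) is `Y (i-1)`.  The fields `Y_zero`, `Y_succ`
say `Y₁ = z X^{ε₁}`, `Y_{i+1} = T_i Y_i T_i`, and `E_def` is the equation
`T_i Y_i = Y_{i+1} T_i - (q - q⁻¹) Y_{i+1} (1 - E_i)` defining `E_i`. -/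
structure AffBMW (C : Type*) [CommRing C] (k : ℕ) (q z : Cˣ) (Z₀ : ℤ → C)
    (A : Type*) [Ring A] [Algebra C A] where
  T : ∀ i : ℕ, i + 1 < k → A
  Tinv : ∀ i : ℕ, i + 1 < k → A
  X : A
  E : ∀ i : ℕ, i + 1 < k → A
  Y : ℕ → A
  Yinv : ℕ → A
  T_Tinv : ∀ i (h : i + 1 < k), T i h * Tinv i h = 1
  Tinv_T : ∀ i (h : i + 1 < k), Tinv i h * T i h = 1
  braid_far : ∀ i j (hi : i + 1 < k) (hj : j + 1 < k), i + 2 ≤ j →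
      T i hi * T j hj = T j hj * T i hi
  braid : ∀ i (h : i + 2 < k),
      T i (by omega) * T (i + 1) h * T i (by omega) =
        T (i + 1) h * T i (by omega) * T (i + 1) h
  XTXT : ∀ h : 1 < k, X * T 0 h * X * T 0 h = T 0 h * X * T 0 h * X
  X_T : ∀ i (h : i + 1 < k), 1 ≤ i → X * T i h = T i h * X
  Y_zero : Y 0 = (z : C) • X
  Y_succ : ∀ i (h : i + 1 < k), Y (i + 1) = T i h * Y i * T i h
  Y_Yinv : ∀ i, i < k → Y i * Yinv i = 1
  Yinv_Y : ∀ i, i < k → Yinv i * Y i = 1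
  E_def : ∀ i (h : i + 1 < k),
      T i h * Y i =
        Y (i + 1) * T i h -
          ((q : C) - ((q⁻¹ : Cˣ) : C)) • (Y (i + 1) * (1 - E i h))
  E_T : ∀ i (h : i + 1 < k), E i h * T i h = ((z⁻¹ : Cˣ) : C) • E i h
  T_E : ∀ i (h : i + 1 < k), T i h * E i h = ((z⁻¹ : Cˣ) : C) • E i h
  E_Tinv : ∀ i (h : i + 1 < k), E i h * Tinv i h = (z : C) • E i h
  Tinv_E : ∀ i (h : i + 1 < k), Tinv i h * E i h = (z : C) • E i h
  ETE_up : ∀ i (h : i + 1 < k) (h' : i + 2 < k),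
      E i h * T (i + 1) h' * E i h = (z : C) • E i h
  ETinvE_up : ∀ i (h : i + 1 < k) (h' : i + 2 < k),
      E i h * Tinv (i + 1) h' * E i h = ((z⁻¹ : Cˣ) : C) • E i h
  ETE_down : ∀ i (h : i + 1 < k) (h' : i - 1 + 1 < k), 1 ≤ i →
      E i h * T (i - 1) h' * E i h = (z : C) • E i h
  ETinvE_down : ∀ i (h : i + 1 < k) (h' : i - 1 + 1 < k), 1 ≤ i →
      E i h * Tinv (i - 1) h' * E i h = ((z⁻¹ : Cˣ) : C) • E i h
  EYE : ∀ (h : 1 < k) (ℓ : ℤ),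
      E 0 h * (if 0 ≤ ℓ then Y 0 ^ ℓ.toNat else Yinv 0 ^ (-ℓ).toNat) * E 0 h =
        Z₀ ℓ • E 0 h
  E_YY : ∀ i (h : i + 1 < k), E i h * (Y i * Y (i + 1)) = E i h
  YY_E : ∀ i (h : i + 1 < k), (Y i * Y (i + 1)) * E i h = E i h

namespace AffBMW

variable {C : Type*} [CommRing C] {k : ℕ} {q z : Cˣ} {Z₀ : ℤ → C} {A : Type*} [Ring A] [Algebra C A]
  (B : AffBMW C k q z Z₀ A)

theorem Y_succ_mul_Tinv (i : ℕ) (h : i + 1 < k) : B.Y (i + 1) * B.Tinv i h = B.T i h * B.Y i := by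
  rw [B.Y_succ i h, mul_assoc, B.T_Tinv, mul_one]

theorem Tinv_mul_Y_succ (i : ℕ) (h : i + 1 < k) : B.Tinv i h * B.Y (i + 1) = B.Y i * B.T i h := by
  rw [B.Y_succ i h, ← mul_assoc, ← mul_assoc, B.Tinv_T, one_mul]

/-- The skein relation. -/
theorem Tinv_eq (i : ℕ) (h : i + 1 < k) :
    B.Tinv i h = B.T i h - ((q : C) - ((q⁻¹ : Cˣ) : C)) • (1 - B.E i h) := by
  have hY : B.Y (i + 1) * B.Tinv i h =
      B.Y (i + 1) * (B.T i h - ((q : C) - ((q⁻¹ : Cˣ) : C)) • (1 - B.E i h)) := by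
    rw [B.Y_succ_mul_Tinv, B.E_def, mul_sub (B.Y (i + 1)) (B.T i h), mul_smul_comm]
  simpa only [← mul_assoc, B.Yinv_Y _ h, one_mul] using congrArg (B.Yinv (i + 1) * ·) hY

theorem T_mul_T (i : ℕ) (h : i + 1 < k) :
    B.T i h * B.T i h = 1 + ((q : C) - ((q⁻¹ : Cˣ) : C)) •
      (B.T i h - ((z⁻¹ : Cˣ) : C) • B.E i h) := by
  have hT := B.T_Tinv i h
  rw [B.Tinv_eq, mul_sub, mul_smul_comm, mul_sub, mul_one, B.T_E] at hT
  exact sub_eq_iff_eq_add.mp hT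

theorem Tinv_braid (i : ℕ) (h : i + 2 < k) :
    B.Tinv i (by omega) * B.Tinv (i + 1) h * B.Tinv i (by omega) =
      B.Tinv (i + 1) h * B.Tinv i (by omega) * B.Tinv (i + 1) h := by
  have cancel : ∀ {a a' b b' : A}, a' * a = 1 → b' * b = 1 → a' * b' * a' * (a * b * a) = 1 := by
    intro a a' b b' ha hb
    simp only [mul_assoc]
    rw [← mul_assoc a' a, ha, one_mul, ← mul_assoc b' b, hb, one_mul, ha]
  refine left_inv_eq_right_inv (cancel (B.Tinv_T i _) (B.Tinv_T (i + 1) h)) ?_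
  rw [B.braid i h]
  exact cancel (B.T_Tinv (i + 1) h) (B.T_Tinv i _)

theorem conj_T (i : ℕ) (h : i + 2 < k) :
    B.T i (by omega) * B.T (i + 1) h * B.T i (by omega) *
      B.Tinv (i + 1) h * B.Tinv i (by omega) = B.T (i + 1) h := by
  rw [B.braid i h, mul_assoc _ _ (B.Tinv (i + 1) h), B.T_Tinv, mul_one, mul_assoc, B.T_Tinv,
    mul_one]

theorem conj_Tinv (i : ℕ) (h : i + 2 < k) :
    B.T i (by omega) * B.T (i + 1) h * B.Tinv i (by omega) *
      B.Tinv (i + 1) h * B.Tinv i (by omega) = B.Tinv (i + 1) h := by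
  rw [mul_assoc, mul_assoc, ← mul_assoc (B.Tinv i _), B.Tinv_braid i h, mul_assoc, mul_assoc,
    ← mul_assoc (B.T (i + 1) h), B.T_Tinv, one_mul, ← mul_assoc, B.T_Tinv, one_mul]

section Invertible

variable [Invertible ((q : C) - ((q⁻¹ : Cˣ) : C))]

theorem E_eq (i : ℕ) (h : i + 1 < k) :
    B.E i h = 1 - ⅟((q : C) - ((q⁻¹ : Cˣ) : C)) • (B.T i h - B.Tinv i h) := by
  rw [B.Tinv_eq, sub_sub_cancel, smul_smul, invOf_mul_self, one_smul, sub_sub_cancel]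

theorem E_mul_E (i : ℕ) (h : i + 1 < k) :
    B.E i h * B.E i h =
      (1 + ((z : C) - ((z⁻¹ : Cˣ) : C)) * ⅟((q : C) - ((q⁻¹ : Cˣ) : C))) • B.E i h := by
  nth_rewrite 2 [B.E_eq i h]
  rw [mul_sub, mul_one, mul_smul_comm, mul_sub, B.E_T, B.E_Tinv]
  module

theorem E_succ_eq_conj (i : ℕ) (h : i + 2 < k) :
    B.E (i + 1) h =
      B.T i (by omega) * B.T (i + 1) h * B.E i (by omega) *
        B.Tinv (i + 1) h * B.Tinv i (by omega) := by
  have h1 : B.T i (by omega) * B.T (i + 1) h * B.Tinv (i + 1) h * B.Tinv i (by omega) = 1 := by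
    rw [mul_assoc _ _ (B.Tinv (i + 1) h), B.T_Tinv, mul_one, B.T_Tinv]
  rw [B.E_eq i, B.E_eq (i + 1)]
  simp only [mul_sub, sub_mul, mul_smul_comm, smul_mul_assoc, mul_one, h1, B.conj_T i h,
    B.conj_Tinv i h]

theorem mul_E_mul_of_mul_T_mul (i j : ℕ) (hi : i + 1 < k) (hj : j + 1 < k)
    (hT : B.E i hi * B.T j hj * B.E i hi = (z : C) • B.E i hi)
    (hTinv : B.E i hi * B.Tinv j hj * B.E i hi = ((z⁻¹ : Cˣ) : C) • B.E i hi) :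
    B.E i hi * B.E j hj * B.E i hi = B.E i hi := by
  rw [B.E_eq j hj, mul_sub, mul_one, mul_smul_comm, mul_sub, sub_mul, smul_mul_assoc, sub_mul,
    hT, hTinv, B.E_mul_E]
  module

end Invertible

theorem cubic (i : ℕ) (h : i + 1 < k) :
    (B.T i h - algebraMap C A ((z⁻¹ : Cˣ) : C)) *
      (B.T i h + algebraMap C A ((q⁻¹ : Cˣ) : C)) *
      (B.T i h - algebraMap C A (q : C)) = 0 := by
  have hquad : (B.T i h + algebraMap C A ((q⁻¹ : Cˣ) : C)) * (B.T i h - algebraMap C A (q : C)) =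
      -((((q : C) - ((q⁻¹ : Cˣ) : C)) * ((z⁻¹ : Cˣ) : C)) • B.E i h) := by
    have hq : (q : C) * ((q⁻¹ : Cˣ) : C) = 1 := q.mul_inv
    simp only [Algebra.algebraMap_eq_smul_one, add_mul, mul_sub, smul_mul_assoc, mul_smul_comm,
      one_mul, mul_one, B.T_mul_T]
    linear_combination (norm := module) hq • (-1 : A)
  rw [mul_assoc, hquad, mul_neg, mul_smul_comm, sub_mul (B.T i h), B.T_E, ← Algebra.smul_def, sub_self,
    smul_zero, neg_zero]

end AffBMW

/-- identities (2.43)–(2.48) in the affine BMW algebra `W_k` (0-indexed):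
(i) `Yᵢ Tᵢ = Tᵢ Y_{i+1} - (q-q⁻¹)(1-Eᵢ)Y_{i+1}`;
(ii) `Eᵢ = 1 - (Tᵢ - Tᵢ⁻¹)/(q-q⁻¹)`;
(iii) `E_{i+1} = Tᵢ T_{i+1} Eᵢ T_{i+1}⁻¹ Tᵢ⁻¹`;
(iv) `Eᵢ E_{i±1} Eᵢ = Eᵢ`; (v) `Eᵢ² = (1 + (z-z⁻¹)/(q-q⁻¹)) Eᵢ`;
(vi) `(Tᵢ - z⁻¹)(Tᵢ + q⁻¹)(Tᵢ - q) = 0`. -/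
theorem affine_BMW_identities
    (C : Type*) [CommRing C] (k : ℕ) (q z : Cˣ) (Z₀ : ℤ → C)
    (A : Type*) [Ring A] [Algebra C A]
    [Invertible ((q : C) - ((q⁻¹ : Cˣ) : C))]
    (hk : 3 ≤ k)
    (B : AffBMW C k q z Z₀ A) :
    (∀ i (h : i + 1 < k),
        B.Y i * B.T i h =
          B.T i h * B.Y (i + 1) -
            ((q : C) - ((q⁻¹ : Cˣ) : C)) • ((1 - B.E i h) * B.Y (i + 1))) ∧
    (∀ i (h : i + 1 < k),
        B.E i h = 1 - ⅟((q : C) - ((q⁻¹ : Cˣ) : C)) • (B.T i h - B.Tinv i h)) ∧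
    (∀ i (h : i + 2 < k),
        B.E (i + 1) h =
          B.T i (by omega) * B.T (i + 1) h * B.E i (by omega) *
            B.Tinv (i + 1) h * B.Tinv i (by omega)) ∧
    (∀ i (h : i + 2 < k),
        B.E i (by omega) * B.E (i + 1) h * B.E i (by omega) = B.E i (by omega) ∧
        B.E (i + 1) h * B.E i (by omega) * B.E (i + 1) h = B.E (i + 1) h) ∧
    (∀ i (h : i + 1 < k),
        B.E i h * B.E i h =
          (1 + ((z : C) - ((z⁻¹ : Cˣ) : C)) * ⅟((q : C) - ((q⁻¹ : Cˣ) : C))) • B.E i h) ∧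
    (∀ i (h : i + 1 < k),
        (B.T i h - algebraMap C A ((z⁻¹ : Cˣ) : C)) *
          (B.T i h + algebraMap C A ((q⁻¹ : Cˣ) : C)) *
          (B.T i h - algebraMap C A (q : C)) = 0) := by
  refine ⟨fun i h => ?_, B.E_eq, B.E_succ_eq_conj, fun i h => ⟨?_, ?_⟩, B.E_mul_E, B.cubic⟩
  · rw [← B.Tinv_mul_Y_succ i h, B.Tinv_eq, sub_mul, smul_mul_assoc]
  · exact B.mul_E_mul_of_mul_T_mul _ _ _ _ (B.ETE_up i _ h) (B.ETinvE_up i _ h)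
  · exact B.mul_E_mul_of_mul_T_mul _ _ _ _ (B.ETE_down (i + 1) h (by simp; omega) (by omega))
      (B.ETinvE_down (i + 1) h (by simp; omega) (by omega))
end

section
/- (First intertwiner-like identity, degenerate case.) Assume 2 is invertible in C. In the ring of formal Laurent series in u⁻¹ with coefficients in 𝓦_k, for every 1 ≤ i ≤ k−1: ( e_i·(1/(u−y_{i+1})) − t_{s_i} − 1/(2u−(y_i+y_{i+1})) ) · ( e_i·(1/(u−y_i)) + t_{s_i} − 1/(2u−(y_i+y_{i+1})) ) = −(2u−(y_i+y_{i+1})+1)(2u−(y_i+y_{i+1})−1) / (2u−(y_i+y_{i+1}))². -/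
noncomputable section

/-- `1/(u - a) := Σ_{ℓ≥1} a^{ℓ-1} u^{-ℓ}`, a formal Laurent series in `u⁻¹`
(an element of `LaurentSeries A = HahnSeries ℤ A` whose variable is `u⁻¹`). -/
def invU {A : Type*} [Ring A] (a : A) : LaurentSeries A :=
  HahnSeries.ofPowerSeries ℤ A (PowerSeries.mk fun n => if n = 0 then 0 else a ^ (n - 1))

/-- `1/(2u - a) := Σ_{ℓ≥1} a^{ℓ-1} (2u)^{-ℓ}` (needs `2` invertible in `C`). -/
def inv2U (C : Type*) [CommRing C] [Invertible (2 : C)]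
    {A : Type*} [Ring A] [Algebra C A] (a : A) : LaurentSeries A :=
  HahnSeries.ofPowerSeries ℤ A
    (PowerSeries.mk fun n => if n = 0 then 0 else ((⅟2 : C) ^ n) • a ^ (n - 1))

/-- The variable `u` itself (the inverse of the Laurent series variable `u⁻¹`). -/
def Uvar (A : Type*) [Ring A] : LaurentSeries A := HahnSeries.single (-1 : ℤ) 1

/-- A constant Laurent series. -/
def cst {A : Type*} [Ring A] (a : A) : LaurentSeries A := HahnSeries.C a

end

/-- The variable of the Laurent series ring commutes with every Laurent series. -/
theorem Uvar_commute {A : Type*} [Ring A] (f : LaurentSeries A) : Commute (Uvar A) f := by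
  ext n
  have h₁ := HahnSeries.coeff_single_mul_add (r := (1 : A)) (x := f) (a := n + 1) (b := (-1 : ℤ))
  have h₂ := HahnSeries.coeff_mul_single_add (r := (1 : A)) (x := f) (a := n + 1) (b := (-1 : ℤ))
  simp only [add_neg_cancel_right, one_mul, mul_one] at h₁ h₂
  exact h₁.trans h₂.symm

theorem invU_eq_ofPowerSeries {A : Type*} [Ring A] (a : A) :
    invU a = HahnSeries.ofPowerSeries ℤ A (PowerSeries.X * PowerSeries.mk fun n => a ^ n) := by
  unfold invU
  congr 1
  ext n
  cases n <;> simp [PowerSeries.coeff_succ_X_mul]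

theorem Uvar_mul_ofPowerSeries_X {A : Type*} [Ring A] :
    Uvar A * HahnSeries.ofPowerSeries ℤ A PowerSeries.X = 1 := by
  simp [Uvar]

theorem one_sub_C_mul_X_mul_mk_pow {A : Type*} [Ring A] (a : A) :
    (1 - PowerSeries.C a * PowerSeries.X) * PowerSeries.mk (fun n => a ^ n) = 1 := by
  ext n
  cases n <;> simp [sub_mul, mul_assoc, PowerSeries.coeff_succ_X_mul, PowerSeries.coeff_one,
    pow_succ']

theorem mk_pow_mul_one_sub_C_mul_X {A : Type*} [Ring A] (a : A) :
    PowerSeries.mk (fun n => a ^ n) * (1 - PowerSeries.C a * PowerSeries.X) = 1 := by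
  ext n
  cases n <;> simp [mul_sub, ← mul_assoc, PowerSeries.coeff_succ_mul_X, PowerSeries.coeff_one,
    pow_succ]

theorem Uvar_sub_cst {A : Type*} [Ring A] (a : A) :
    Uvar A - cst a =
      Uvar A * HahnSeries.ofPowerSeries ℤ A (1 - PowerSeries.C a * PowerSeries.X) := by
  rw [map_sub, map_mul, mul_sub, map_one, mul_one, ← mul_assoc, (Uvar_commute _).eq, mul_assoc,
    Uvar_mul_ofPowerSeries_X, mul_one, HahnSeries.ofPowerSeries_C]
  rfl

theorem Uvar_sub_cst_mul_invU {A : Type*} [Ring A] (a : A) :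
    (Uvar A - cst a) * invU a = 1 := by
  rw [invU_eq_ofPowerSeries, Uvar_sub_cst, mul_assoc, ← map_mul, ← mul_assoc,
    (PowerSeries.commute_X _).eq, mul_assoc, one_sub_C_mul_X_mul_mk_pow, mul_one,
    Uvar_mul_ofPowerSeries_X]

theorem invU_mul_Uvar_sub_cst {A : Type*} [Ring A] (a : A) :
    invU a * (Uvar A - cst a) = 1 := by
  rw [invU_eq_ofPowerSeries, Uvar_sub_cst, ← mul_assoc, ← (Uvar_commute _).eq, mul_assoc,
    ← map_mul, mul_assoc, mk_pow_mul_one_sub_C_mul_X, mul_one, Uvar_mul_ofPowerSeries_X]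

theorem inv2U_eq_invU (C : Type*) [CommRing C] [Invertible (2 : C)]
    {A : Type*} [Ring A] [Algebra C A] (a : A) :
    inv2U C a = cst (algebraMap C A ⅟2) * invU ((⅟2 : C) • a) := by
  have hC : (cst (algebraMap C A ⅟2) : LaurentSeries A) =
      HahnSeries.ofPowerSeries ℤ A (PowerSeries.C (algebraMap C A ⅟2)) :=
    (HahnSeries.ofPowerSeries_C _).symm
  rw [hC]
  unfold inv2U invU
  rw [← map_mul]
  congr 1
  ext n
  cases n <;> simp [smul_pow, pow_succ, mul_smul, ← Algebra.smul_def]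

theorem cst_commute {A : Type*} [Ring A] {c : A} (hc : ∀ b, Commute c b)
    (f : LaurentSeries A) : Commute (cst c) f := by
  ext n
  simp only [cst, HahnSeries.C_apply]
  have h₁ := HahnSeries.coeff_single_mul_add (r := c) (x := f) (a := n) (b := (0 : ℤ))
  have h₂ := HahnSeries.coeff_mul_single_add (r := c) (x := f) (a := n) (b := (0 : ℤ))
  rw [add_zero] at h₁ h₂
  exact h₁.trans ((hc _).trans h₂.symm)

theorem two_mul_Uvar_sub_cst (C : Type*) [CommRing C] [Invertible (2 : C)]
    {A : Type*} [Ring A] [Algebra C A] (a : A) :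
    2 * Uvar A - cst a = 2 * (Uvar A - cst ((⅟2 : C) • a)) := by
  have h : (2 : LaurentSeries A) * cst ((⅟2 : C) • a) = cst a := by
    unfold cst
    rw [two_mul, ← map_add, ← add_smul, invOf_two_add_invOf_two, one_smul]
  rw [mul_sub, h]

theorem two_mul_cst_invOf_two (C : Type*) [CommRing C] [Invertible (2 : C)]
    {A : Type*} [Ring A] [Algebra C A] :
    (2 : LaurentSeries A) * cst (algebraMap C A ⅟2) = 1 := by
  unfold cst
  rw [two_mul, ← map_add, ← map_add, invOf_two_add_invOf_two, map_one, map_one]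

theorem two_mul_Uvar_sub_cst_mul_inv2U (C : Type*) [CommRing C] [Invertible (2 : C)]
    {A : Type*} [Ring A] [Algebra C A] (a : A) :
    (2 * Uvar A - cst a) * inv2U C a = 1 := by
  rw [inv2U_eq_invU, two_mul_Uvar_sub_cst C, ← mul_assoc, mul_assoc 2,
    ← (cst_commute (fun b => Algebra.commutes _ b) _).eq, ← mul_assoc,
    two_mul_cst_invOf_two, one_mul, Uvar_sub_cst_mul_invU]

theorem inv2U_mul_two_mul_Uvar_sub_cst (C : Type*) [CommRing C] [Invertible (2 : C)]
    {A : Type*} [Ring A] [Algebra C A] (a : A) :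
    inv2U C a * (2 * Uvar A - cst a) = 1 := by
  rw [inv2U_eq_invU, two_mul_Uvar_sub_cst C, mul_assoc, ← mul_assoc _ 2,
    ← (Commute.ofNat_left 2 _).eq, mul_assoc, invU_mul_Uvar_sub_cst, mul_one,
    ← (Commute.ofNat_left 2 _).eq, two_mul_cst_invOf_two]

/-- An element commuting with `d` commutes with a two-sided inverse `w` of `d`. -/
theorem Commute.of_mul_eq_one {R : Type*} [Monoid R] {d w x : R} (hdw : d * w = 1)
    (hwd : w * d = 1) (hx : Commute d x) : Commute w x :=
  Commute.units_inv_left (u := ⟨d, w, hdw, hwd⟩) hx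

/-- The intertwiner identity in an arbitrary ring, where `x`, `x'`, `w` are inverses of
`u - y`, `u - y'` and `2u - (y + y')`, and `d` is the value of `2u - (y + y')`. -/
theorem intertwiner_identity {R : Type*} [Ring R] {e t p p' x x' d w : R}
    (hpx : p * x = 1) (hpx' : x' * p' = 1)
    (hd : d = p' + p) (hdw : d * w = 1) (hwd : w * d = 1)
    (htt : t * t = 1) (hte : t * e = e * t)
    (hde : Commute d e) (hdt : Commute d t) (hdp : Commute d p)
    (htp : t * p = p' * t + (1 - e)) (hxp : x * p = 1) :
    (e * x' - t - w) * (e * x + t - w) = -((d + 1) * (d - 1) * (w * w)) := by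
  have hwe : Commute w e := .of_mul_eq_one hdw hwd hde
  have hwt : Commute w t := .of_mul_eq_one hdw hwd hdt
  have hwp : Commute w p := .of_mul_eq_one hdw hwd hdp
  have hxw : Commute x w := .of_mul_eq_one hpx hxp hwp.symm
  have hxt : x' * t = t * x + x' * (1 - e) * x := by
    have h : x' * (t * p) * x = x' * (p' * t + (1 - e)) * x := by rw [htp]
    rw [mul_add, add_mul, ← mul_assoc x' p', hpx', one_mul, ← mul_assoc, mul_assoc _ p, hpx,
      mul_one] at h
    exact h
  have hxx : x' * x = (x + x') * w := by
    have h : x' * d * x = x + x' := by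
      rw [hd, mul_add, hpx', add_mul, one_mul, mul_assoc, hpx, mul_one]
    rw [← h, mul_assoc, hxw.eq, mul_assoc, ← mul_assoc d, hdw, one_mul]
  have hright : (d + 1) * (d - 1) * (w * w) = 1 - w * w := by
    have h : d * d * (w * w) = 1 := by rw [mul_assoc, ← mul_assoc d w, hdw, one_mul, hdw]
    calc (d + 1) * (d - 1) * (w * w) = d * d * (w * w) - w * w := by noncomm_ring
      _ = 1 - w * w := by rw [h]
  have hwex : w * (e * x) = e * x * w := by
    rw [← mul_assoc, hwe.eq, mul_assoc, ← hxw.eq, mul_assoc]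
  have hext : e * x' * t = t * (e * x) + (e * x * w + e * x' * w) - e * x' * (e * x) :=
    calc e * x' * t = e * (x' * t) := mul_assoc _ _ _
      _ = e * t * x + e * (x' * x) - e * x' * (e * x) := by rw [hxt]; noncomm_ring
      _ = t * (e * x) + (e * x * w + e * x' * w) - e * x' * (e * x) := by
        rw [← hte, hxx]; noncomm_ring
  calc (e * x' - t - w) * (e * x + t - w)
      = e * x' * (e * x) + e * x' * t - e * x' * w - t * (e * x) - t * t
          + t * w - w * (e * x) - w * t + w * w := by noncomm_ring
    _ = -(1 - w * w) := by rw [hext, htt, hwex, hwt.eq]; abel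
    _ = _ := by rw [hright]

/-- first intertwiner-like identity, degenerate case; (3.3) of the paper:
in formal Laurent series in `u⁻¹` over `𝓦ₖ` (0-indexed),
`(eᵢ (1/(u-y_{i+1})) - t_{sᵢ} - 1/(2u-(yᵢ+y_{i+1}))) (eᵢ (1/(u-yᵢ)) + t_{sᵢ} - 1/(2u-(yᵢ+y_{i+1})))
  = -(2u-(yᵢ+y_{i+1})+1)(2u-(yᵢ+y_{i+1})-1)/(2u-(yᵢ+y_{i+1}))²`. -/
theorem degenerate_affine_BMW_first_intertwiner
    (C : Type*) [CommRing C] [Invertible (2 : C)] (k : ℕ) (ε : C) (z₀ : ℕ → C)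
    (A : Type*) [Ring A] [Algebra C A]
    (hk : 2 ≤ k) (hε : ε = 1 ∨ ε = -1)
    (B : DegAffBMW C k ε z₀ A) :
    ∀ i (h : i + 1 < k),
      (cst (B.e i h) * invU (B.y (i + 1)) - cst (B.t (sw k i h)) -
            inv2U C (B.y i + B.y (i + 1))) *
          (cst (B.e i h) * invU (B.y i) + cst (B.t (sw k i h)) -
            inv2U C (B.y i + B.y (i + 1))) =
        -((2 * Uvar A - cst (B.y i + B.y (i + 1)) + 1) *
            (2 * Uvar A - cst (B.y i + B.y (i + 1)) - 1) *
            (inv2U C (B.y i + B.y (i + 1)) * inv2U C (B.y i + B.y (i + 1)))) := by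
  intro i h
  have hC : ∀ a : A, cst a = HahnSeries.C a := fun _ => rfl
  have htt : B.t (sw k i h) * B.t (sw k i h) = 1 := by
    rw [B.t_mul, sw, Equiv.swap_mul_self, B.t_one]
  have hcomm : ∀ {b : A}, Commute (B.y i + B.y (i + 1)) b →
      Commute (2 * Uvar A - cst (B.y i + B.y (i + 1))) (cst b) := fun {b} hb =>
    ((Commute.ofNat_left 2 _).mul_left (Uvar_commute _)).sub_left
      (hb.map (HahnSeries.C : A →+* LaurentSeries A))
  refine intertwiner_identity (p := Uvar A - cst (B.y i)) (p' := Uvar A - cst (B.y (i + 1)))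
    (Uvar_sub_cst_mul_invU _) (invU_mul_Uvar_sub_cst _) ?_
    (two_mul_Uvar_sub_cst_mul_inv2U C _) (inv2U_mul_two_mul_Uvar_sub_cst C _) ?_ ?_ ?_ ?_ ?_ ?_
    (invU_mul_Uvar_sub_cst _)
  · rw [hC, map_add, two_mul]
    simp only [hC]
    abel
  · rw [hC, ← map_mul, htt, map_one]
  · rw [hC, hC, ← map_mul, ← map_mul, B.t_e, B.e_t]
  · exact hcomm ((B.yy_e i h).trans (B.e_yy i h).symm)
  · exact hcomm (B.t_yy i h).symm
  · refine .sub_right (Uvar_commute _).symm (hcomm ?_)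
    exact (Commute.refl _).add_left (B.y_comm _ _ h (by omega))
  · have := congrArg (HahnSeries.C : A →+* LaurentSeries A) (B.e_def i h)
    simp only [map_mul, map_sub, map_one] at this
    simp only [hC]
    rw [mul_sub, this, sub_mul, (Uvar_commute _).eq]
    abel
end
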